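/- Let X be a Hausdorff topological space satisfying the first axiom of countability and let A ⊆ X. Then A is closed in X if and only if for every subset M ⊆ A and every point x ∈ X with x ∉ A, the abelian group C(M ∪ {x}; ℤ) of continuous integer-valued functions on M ∪ {x} is isomorphic to the direct product C(M; ℤ) × ℤ. -/

import Mathlib

open Filter Topology

theorem stmt12_aux_fwd {X : Type*} [TopologicalSpace X] [T2Space X]
    (A : Set X) (hA : IsClosed A) (M : Set X) (hM : M ⊆ A) (x : X) (hx : x ∉ A) :
    Nonempty (C((insert x M : Set X), ℤ) ≃+ C(M, ℤ) × ℤ) := by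
  classical
  have hxM : x ∉ M := fun h => hx (hM h)
  let i : C(M, (insert x M : Set X)) :=
    ⟨fun m => ⟨m.1, Set.mem_insert_of_mem _ m.2⟩, by fun_prop⟩
  let x0 : (insert x M : Set X) := ⟨x, Set.mem_insert _ _⟩
  let φ : C((insert x M : Set X), ℤ) →+ C(M, ℤ) × ℤ :=
    { toFun := fun f => (f.comp i, f x0)
      map_zero' := rfl
      map_add' := fun _ _ => rfl }
  refine ⟨AddEquiv.ofBijective φ ⟨?_, ?_⟩⟩
  · intro f g h
    have h1 : f.comp i = g.comp i := congrArg Prod.fst h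
    have h2 : f x0 = g x0 := congrArg Prod.snd h
    ext ⟨p, hp⟩
    rcases hp with rfl | hp
    · exact h2
    · exact DFunLike.congr_fun h1 ⟨p, hp⟩
  · rintro ⟨g, k⟩
    let F : ↥(insert x M : Set X) → ℤ := fun p => if h : p.1 ∈ M then g ⟨p.1, h⟩ else k
    have hF : Continuous F := by
      rw [continuous_iff_continuousAt]
      rintro ⟨p, hp⟩
      by_cases hpM : p ∈ M
      · have hemb : IsOpenEmbedding i := by
          refine ⟨⟨⟨?_⟩, ?_⟩, ?_⟩
          · have : IsInducing ((Subtype.val : ↥(insert x M : Set X) → X) ∘ i) :=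
              IsInducing.subtypeVal
            exact (this.of_comp i.continuous continuous_subtype_val).eq_induced
          · intro a b h
            exact Subtype.ext (congrArg (fun q => q.1) h)
          · have : Set.range i = {x0}ᶜ := by
              ext ⟨q, hq⟩
              constructor
              · rintro ⟨m, hm⟩ h
                have h1 : m.1 = q := congrArg Subtype.val hm
                have h2 : q = x := congrArg Subtype.val h
                exact hxM (h2 ▸ h1 ▸ m.2)
              · intro h
                have : q ∈ M := hq.resolve_left (fun h' => h (Subtype.ext h'))
                exact ⟨⟨q, this⟩, rfl⟩
            rw [this]
            exact isOpen_compl_singleton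
        have : F ∘ i = g := by
          funext m
          simp [F, i]
        have h2 := (hemb.continuousAt_iff (g := F) (x := ⟨p, hpM⟩)).1
          (by rw [this]; exact g.continuous.continuousAt)
        exact h2
      · have hpx : p = x := hp.resolve_right hpM
        have : ∀ᶠ q in 𝓝 (⟨p, hp⟩ : (insert x M : Set X)), F q = k := by
          have h1 : ∀ᶠ q in 𝓝 p, q ∉ A := hA.isOpen_compl.mem_nhds (by rw [hpx]; exact hx)
          filter_upwards [continuous_subtype_val.continuousAt.eventually h1] with q hq
          exact dif_neg (fun h => hq (hM h))
        exact (continuousAt_const (y := k)).congr (this.mono fun _ h => h.symm)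
    refine ⟨⟨F, hF⟩, ?_⟩
    refine Prod.ext ?_ ?_
    · ext m
      exact dif_pos m.2
    · exact dif_neg hxM

/-- Range of a sequence converging to a point `x` outside it. -/
theorem stmt12_aux_bwd {X : Type*} [TopologicalSpace X] [T2Space X]
    (u : ℕ → X) (x : X) (hu : Tendsto u atTop (𝓝 x)) (hne : ∀ n, u n ≠ x)
    (e : C((insert x (Set.range u) : Set X), ℤ) ≃+ C(Set.range u, ℤ) × ℤ) : False := by
  classical
  have hfin : ∀ V ∈ 𝓝 x, (Set.range u \ V).Finite := by
    intro V hV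
    obtain ⟨N, hN⟩ := eventually_atTop.1 (hu.eventually hV)
    refine ((Set.finite_lt_nat N).image u).subset ?_
    rintro _ ⟨⟨n, rfl⟩, hn⟩
    exact ⟨n, not_le.1 fun h => hn (hN n h), rfl⟩
  have hinf : (Set.range u).Infinite := by
    intro hf
    obtain ⟨n, hn⟩ := hf.isClosed.mem_of_tendsto hu (Eventually.of_forall fun n => ⟨n, rfl⟩)
    exact hne n hn
  have hdisc : DiscreteTopology (Set.range u) := by
    rw [discreteTopology_iff_isOpen_singleton]
    rintro ⟨p, hp⟩
    have hpx : p ≠ x := by obtain ⟨n, rfl⟩ := hp; exact hne n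
    obtain ⟨U, V, hU, hV, hpU, hxV, hd⟩ := t2_separation hpx
    have hf : ((Set.range u \ V) \ {p}).Finite := (hfin V (hV.mem_nhds hxV)).subset Set.sdiff_subset
    refine ⟨U ∩ ((Set.range u \ V) \ {p})ᶜ, hU.inter hf.isClosed.isOpen_compl, ?_⟩
    ext ⟨q, hq⟩
    simp only [Set.mem_preimage, Set.mem_singleton_iff, Subtype.mk.injEq]
    constructor
    · rintro ⟨h1, h2⟩
      by_contra h3
      exact h2 ⟨⟨hq, fun h => Set.disjoint_left.1 hd h1 h⟩, h3⟩
    · rintro rfl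
      exact ⟨hpU, fun h => h.2 rfl⟩
  let x0 : (insert x (Set.range u) : Set X) := ⟨x, Set.mem_insert _ _⟩
  have hcK : Countable (insert x (Set.range u) : Set X) :=
    ((Set.countable_range u).insert x).to_subtype
  have hsupp : ∀ f : C((insert x (Set.range u) : Set X), ℤ),
      (Function.support fun p => f p - f x0).Finite := by
    intro f
    have h1 : ∀ᶠ p in 𝓝 x0, f p = f x0 :=
      f.continuous.continuousAt.eventually (f := f) (mem_nhds_discrete.2 rfl : {f x0} ∈ 𝓝 (f x0))
    rw [eventually_iff, mem_nhds_subtype] at h1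
    obtain ⟨V, hV, hVs⟩ := h1
    refine ((hfin V hV).preimage Subtype.val_injective.injOn).subset ?_
    rintro ⟨q, hq⟩ h
    have hqV : q ∉ V := fun h' => h (sub_eq_zero.2 (hVs h'))
    refine ⟨hq.resolve_left ?_, hqV⟩
    rintro rfl
    exact hqV (mem_of_mem_nhds hV)
  have hcount : Countable C((insert x (Set.range u) : Set X), ℤ) := by
    let G : C((insert x (Set.range u) : Set X), ℤ) →
        ((insert x (Set.range u) : Set X) →₀ ℤ) × ℤ :=
      fun f => (Finsupp.ofSupportFinite _ (hsupp f), f x0)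
    refine Function.Injective.countable (f := G) ?_
    intro f g h
    have h1 := congrArg Prod.fst h
    have h2 : f x0 = g x0 := congrArg Prod.snd h
    ext p
    have h3 : f p - f x0 = g p - g x0 := DFunLike.congr_fun h1 p
    omega
  have hc2 : Countable C(Set.range u, ℤ) :=
    Function.Injective.countable (f := fun g => e.symm (g, 0))
      (fun a b h => congrArg Prod.fst (e.symm.injective h))
  have hI : Infinite (Set.range u) := hinf.to_subtype
  have hc3 : Countable (Set (Set.range u)) := by
    refine Function.Injective.countable
      (f := fun S : Set (Set.range u) =>
        (⟨S.indicator 1, continuous_of_discreteTopology⟩ : C(Set.range u, ℤ))) ?_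
    intro S T h
    ext p
    have h1 : S.indicator (1 : Set.range u → ℤ) p = T.indicator 1 p := DFunLike.congr_fun h p
    by_cases hS : p ∈ S <;> by_cases hT : p ∈ T <;> simp_all
  have : Uncountable (Set (Set.range u)) := by
    let j := Infinite.natEmbedding (Set.range u)
    refine ⟨fun hc => ?_⟩
    have hN : Countable (Set ℕ) :=
      Function.Injective.countable (f := fun S => Set.image j S) j.injective.image_injective
    obtain ⟨f, hf⟩ := exists_surjective_nat (Set ℕ)
    exact Function.cantor_surjective f hf
  exact not_countable_iff.2 this hc3

/-- In a first-countable Hausdorff space `X`, a subset `A` is closed if and only if for every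
`M ⊆ A` and every `x ∉ A`, the group `C(M ∪ {x}; ℤ)` of continuous integer-valued functions
is isomorphic to `C(M; ℤ) × ℤ`. -/
theorem stmt12 {X : Type*} [TopologicalSpace X] [T2Space X] [FirstCountableTopology X]
    (A : Set X) :
    IsClosed A ↔ ∀ M : Set X, M ⊆ A → ∀ x : X, x ∉ A →
      Nonempty (C((insert x M : Set X), ℤ) ≃+ C(M, ℤ) × ℤ) := by
  constructor
  · intro hA M hM x hx
    exact stmt12_aux_fwd A hA M hM x hx
  · intro h
    refine isClosed_of_closure_subset fun x hx => ?_
    by_contra hxA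
    obtain ⟨u, huA, hu⟩ := mem_closure_iff_seq_limit.1 hx
    obtain ⟨e⟩ := h (Set.range u) (Set.range_subset_iff.2 huA) x hxA
    exact stmt12_aux_bwd u x hu (fun n hn => hxA (hn ▸ huA n)) e
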